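/- arXiv:2201.01695 — 4 statements merged into one kernel-verified Lean document; each statement's English description precedes it below -/
import Mathlib

section
/- Let V be a real inner product space with finrank ℝ V = 2, let J : V →ₗ[ℝ] V satisfy J ∘ J = −id and ⟨J x, J y⟩ = ⟨x, y⟩ for all x, y, let B : V →ₗ[ℝ] V be symmetric (⟨B x, y⟩ = ⟨x, B y⟩ for all x, y) with trace tr B, and let v₀ ∈ V. Then for all u, v, w ∈ V: ⟨v₀, u⟩·⟨B v, J w⟩ − ⟨v₀, v⟩·⟨B u, J w⟩ = ⟨J u, v⟩·((tr B)·⟨v₀, w⟩ − ⟨B v₀, w⟩). -/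
open scoped RealInnerProductSpace

/-- In an oriented plane with orthogonal complex structure `J`, some pair `(e, J e)` is an
orthonormal basis. -/
lemma exists_orthonormalBasis_complexStructure {V : Type*} [NormedAddCommGroup V]
    [InnerProductSpace ℝ V] (hdim : Module.finrank ℝ V = 2)
    (J : V →ₗ[ℝ] V) (hJ2 : ∀ x : V, J (J x) = -x)
    (hJinner : ∀ x y : V, ⟪J x, J y⟫ = ⟪x, y⟫) :
    ∃ b : OrthonormalBasis (Fin 2) ℝ V, b 1 = J (b 0) := by
  have : Nontrivial V := Module.nontrivial_of_finrank_pos (R := ℝ) (by omega)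
  obtain ⟨e, he⟩ := exists_norm_eq V zero_le_one
  have hJe : ‖J e‖ = 1 := ((J.isometryOfInner hJinner).norm_map e).trans he
  have heJ : ⟪e, J e⟫ = 0 := by
    have h := hJinner e (J e)
    rw [hJ2, inner_neg_right, real_inner_comm] at h
    linarith
  have ho : Orthonormal ℝ ![e, J e] := by
    rw [orthonormal_iff_ite]
    intro i j
    fin_cases i <;> fin_cases j <;> simp [heJ, hJe, he, real_inner_comm e (J e)]
  have hcard : Fintype.card (Fin 2) = Module.finrank ℝ V := by simp [hdim]
  have hb : ⇑(basisOfOrthonormalOfCardEqFinrank ho hcard) = ![e, J e] := by simp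
  refine ⟨(basisOfOrthonormalOfCardEqFinrank ho hcard).toOrthonormalBasis (by rwa [hb]), ?_⟩
  simp

theorem stmt_0 {V : Type*} [NormedAddCommGroup V] [InnerProductSpace ℝ V]
    (hdim : Module.finrank ℝ V = 2)
    (J : V →ₗ[ℝ] V) (hJ2 : ∀ x : V, J (J x) = -x)
    (hJinner : ∀ x y : V, ⟪J x, J y⟫ = ⟪x, y⟫)
    (B : V →ₗ[ℝ] V) (hB : ∀ x y : V, ⟪B x, y⟫ = ⟪x, B y⟫)
    (v₀ : V) :
    ∀ u v w : V,
      ⟪v₀, u⟫ * ⟪B v, J w⟫ - ⟪v₀, v⟫ * ⟪B u, J w⟫ =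
        ⟪J u, v⟫ * ((LinearMap.trace ℝ V B) * ⟪v₀, w⟫ - ⟪B v₀, w⟫) := by
  intro u v w
  obtain ⟨b, hb⟩ := exists_orthonormalBasis_complexStructure hdim J hJ2 hJinner
  have hJ1 : J (b 1) = -b 0 := by rw [hb, hJ2]
  have h00 : ⟪b 0, b 0⟫ = 1 := by simp
  have h11 : ⟪b 1, b 1⟫ = 1 := by simp
  have h01 : ⟪b 0, b 1⟫ = 0 := b.orthonormal.2 (by decide)
  have h10 : ⟪b 1, b 0⟫ = 0 := b.orthonormal.2 (by decide)
  have hB01 : ⟪B (b 0), b 1⟫ = ⟪B (b 1), b 0⟫ := by rw [hB, real_inner_comm]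
  have htr : LinearMap.trace ℝ V B = ⟪B (b 0), b 0⟫ + ⟪B (b 1), b 1⟫ := by
    rw [LinearMap.trace_eq_sum_inner B b, Fin.sum_univ_two, ← hB, ← hB]
  have key : ∀ x : V, ∃ p q : ℝ, x = p • b 0 + q • b 1 := fun x =>
    ⟨_, _, by rw [← Fin.sum_univ_two (fun i => ⟪b i, x⟫ • b i), b.sum_repr']⟩
  obtain ⟨u₁, u₂, rfl⟩ := key u
  obtain ⟨v₁, v₂, rfl⟩ := key v
  obtain ⟨w₁, w₂, rfl⟩ := key w
  obtain ⟨x₁, x₂, rfl⟩ := key v₀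
  simp only [map_add, map_smul, ← hb, hJ1, inner_add_left, inner_add_right, real_inner_smul_left,
    real_inner_smul_right, inner_neg_left, inner_neg_right, h00, h11, h01, h10, hB01, htr]
  ring
end

section
/- Let V and V̂ be real Banach spaces, let L : V → V̂ be C² on a neighborhood of 0 with L(0) = 0, set Φ = fderiv ℝ L 0, let W be a closed submodule of V̂, and let π : V̂ →L[ℝ] V̂ be a continuous linear map with π(Φ u) = 0 for all u ∈ V and π(w) = w for all w ∈ W. If x : ℝ → V is C² on a neighborhood of 0 with x(0) = 0, deriv x 0 = v where Φ v = 0, and L(x(t)) ∈ W for all t in a neighborhood of 0, then deriv (deriv (fun t => L (x t))) 0 = π ((fderiv ℝ (fun y => fderiv ℝ L y) 0 v) v), i.e. the second derivative of t ↦ L(x(t)) at t = 0 equals π applied to the second Fréchet derivative of L at 0 evaluated on (v, v). -/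
open Filter

/-- Second order chain rule along a curve: the derivative at `t` of the velocity of `L ∘ x`. -/
theorem hasDerivAt_deriv_comp_curve {V W : Type*}
    [NormedAddCommGroup V] [NormedSpace ℝ V] [NormedAddCommGroup W] [NormedSpace ℝ W]
    {L : V → W} {x : ℝ → V} {t : ℝ} (hL : ContDiffAt ℝ 2 L (x t)) (hx : ContDiffAt ℝ 2 x t) :
    HasDerivAt (deriv fun r => L (x r))
      (fderiv ℝ (fderiv ℝ L) (x t) (deriv x t) (deriv x t) +
        fderiv ℝ L (x t) (deriv (deriv x) t)) t := by
  have hxd : HasDerivAt x (deriv x t) t := (hx.differentiableAt (by norm_num)).hasDerivAt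
  have hx' : HasDerivAt (deriv x) (deriv (deriv x) t) t := by
    have h : ContDiffAt ℝ 1 (fderiv ℝ x) t := hx.fderiv_right (by norm_num)
    have h' : DifferentiableAt ℝ (fun r => fderiv ℝ x r 1) t :=
      (h.differentiableAt (by norm_num)).clm_apply (differentiableAt_const _)
    exact h'.hasDerivAt
  have hL' : HasFDerivAt (fderiv ℝ L) (fderiv ℝ (fderiv ℝ L) (x t)) (x t) := by
    have h : ContDiffAt ℝ 1 (fderiv ℝ L) (x t) := hL.fderiv_right (by norm_num)
    exact (h.differentiableAt (by norm_num)).hasFDerivAt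
  have hvel : (deriv fun r => L (x r)) =ᶠ[nhds t] fun r => fderiv ℝ L (x r) (deriv x r) := by
    filter_upwards [hx.eventually (by simp),
      hx.continuousAt.eventually (hL.eventually (by simp))] with r hxr hLr
    exact ((hLr.differentiableAt (by norm_num)).hasFDerivAt.comp_hasDerivAt r
      (hxr.differentiableAt (by norm_num)).hasDerivAt).deriv
  exact ((hL'.comp_hasDerivAt t hxd).clm_apply hx').congr_of_eventuallyEq hvel

/-- A continuous linear map that fixes a curve near `t` fixes its second derivative at `t`. -/
theorem ContinuousLinearMap.map_deriv_deriv_eq_self {W : Type*}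
    [NormedAddCommGroup W] [NormedSpace ℝ W] (π : W →L[ℝ] W) {g : ℝ → W} {t : ℝ}
    (hg : ∀ᶠ r in nhds t, DifferentiableAt ℝ g r) (hg' : DifferentiableAt ℝ (deriv g) t)
    (hπ : ∀ᶠ r in nhds t, π (g r) = g r) :
    π (deriv (deriv g) t) = deriv (deriv g) t := by
  have hvel : deriv g =ᶠ[nhds t] fun r => π (deriv g r) := by
    filter_upwards [hg, hπ.eventually_nhds] with r hr hπr
    have hπr' : g =ᶠ[nhds r] fun q => π (g q) := hπr.mono fun _ h => h.symm
    exact hπr'.deriv_eq.trans (π.hasFDerivAt.comp_hasDerivAt r hr.hasDerivAt).deriv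
  exact (hvel.deriv_eq.trans (π.hasFDerivAt.comp_hasDerivAt t hg'.hasDerivAt).deriv).symm

theorem stmt_3 {V W : Type*}
    [NormedAddCommGroup V] [NormedSpace ℝ V]
    [NormedAddCommGroup W] [NormedSpace ℝ W]
    (L : V → W) (s : Set V) (hs : IsOpen s) (h0s : (0 : V) ∈ s)
    (hL : ContDiffOn ℝ 2 L s) (hL0 : L 0 = 0)
    (Wsub : Submodule ℝ W) (hWclosed : IsClosed (Wsub : Set W))
    (π : W →L[ℝ] W)
    (hπΦ : ∀ u : V, π (fderiv ℝ L 0 u) = 0)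
    (hπW : ∀ w ∈ Wsub, π w = w)
    (x : ℝ → V) (sx : Set ℝ) (hsx : IsOpen sx) (h0x : (0 : ℝ) ∈ sx)
    (hx : ContDiffOn ℝ 2 x sx) (hx0 : x 0 = 0)
    (v : V) (hxv : deriv x 0 = v) (hv : fderiv ℝ L 0 v = 0)
    (hLx : ∀ᶠ t in nhds (0 : ℝ), L (x t) ∈ Wsub) :
    deriv (deriv (fun t => L (x t))) 0 =
      π ((fderiv ℝ (fun y => fderiv ℝ L y) 0 v) v) := by
  have hLat : ContDiffAt ℝ 2 L (x 0) := by
    rw [hx0]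
    exact hL.contDiffAt (hs.mem_nhds h0s)
  have hxat : ContDiffAt ℝ 2 x 0 := hx.contDiffAt (hsx.mem_nhds h0x)
  have hsecond := hasDerivAt_deriv_comp_curve hLat hxat
  have hdiff : ∀ᶠ t in nhds (0 : ℝ), DifferentiableAt ℝ (fun t => L (x t)) t :=
    ((hLat.comp 0 hxat).eventually (by simp)).mono fun _ h => h.differentiableAt (by norm_num)
  rw [← π.map_deriv_deriv_eq_self hdiff hsecond.differentiableAt (hLx.mono fun t => hπW (L (x t))),
    hsecond.deriv, hx0, hxv, map_add, hπΦ, add_zero]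
end

section
/- Fix a natural number p ≥ 2 (cast to ℝ), and real numbers r ≠ 0 and K̂ ≠ 0 such that if r < 0 then p > 2 and K̂ < 0. For θ > 0 set ε(θ) = 2(p − 1/p)·r·θ − (p−1)·K̂, c(θ) = (p/4)·(2(p−1)·r·θ − (p−2)·K̂)·θ^(2/(p−1)) (real exponent via Real.rpow), and λ(θ) = 2(p − 1/p)·r·θ − (p−2)·K̂. Define I_r ⊆ (0,∞) by I_r = (θ₊, ∞) with θ₊ = max(p·K̂/(2(p+1)·r), 0) when r > 0, and I_r = (0, θ₋) with θ₋ = p·(p−2)·K̂/(2(p²−1)·r) when r < 0. Then for every real θ > 0, the three numbers ε(θ), c(θ), λ(θ) are simultaneously positive if and only if θ ∈ I_r. -/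
open scoped Classical

/-- For `q ≥ 2` and `x > 0`, positivity of the first quantity forces that of the other two. -/
theorem pos_of_first_pos {q x K : ℝ} (hq : 2 ≤ q) (hx : 0 < x) (h : 0 < 2 * (q + 1) * x - q * K) :
    0 < 2 * (q - 1) * x - (q - 2) * K ∧ 0 < 2 * (q ^ 2 - 1) * x - q * (q - 2) * K := by
  have hx' : 0 < (q - 1) * x := mul_pos (by linarith) hx
  rcases le_or_gt K 0 with hK | hK
  · have hqK : 0 ≤ (q - 2) * -K := mul_nonneg (by linarith) (by linarith)
    constructor <;> nlinarith
  · have h' : 0 < (q - 1) * (2 * (q + 1) * x - q * K) := mul_pos (by linarith) h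
    constructor
    · refine pos_of_mul_pos_right (a := q + 1) ?_ (by linarith)
      nlinarith
    · nlinarith

/-- For `q > 2` and `K < 0`, positivity of the third quantity forces that of the
other two. -/
theorem pos_of_third_pos {q x K : ℝ} (hq : 2 < q) (hK : K < 0)
    (h : 0 < 2 * (q ^ 2 - 1) * x - q * (q - 2) * K) :
    0 < 2 * (q + 1) * x - q * K ∧ 0 < 2 * (q - 1) * x - (q - 2) * K := by
  constructor
  · refine pos_of_mul_pos_right (a := q - 1) ?_ (by linarith)
    nlinarith
  · refine pos_of_mul_pos_right (a := q + 1) ?_ (by linarith)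
    nlinarith [mul_pos (sub_pos.2 hq) (neg_pos.2 hK)]

theorem stmt_5 (p : ℕ) (hp : 2 ≤ p) (r Khat : ℝ) (hr : r ≠ 0) (hK : Khat ≠ 0)
    (hgbt : r < 0 → 2 < p ∧ Khat < 0) :
    ∀ θ : ℝ, 0 < θ →
      ((0 < 2 * ((p : ℝ) - 1 / (p : ℝ)) * r * θ - ((p : ℝ) - 1) * Khat ∧
        0 < ((p : ℝ) / 4) * (2 * ((p : ℝ) - 1) * r * θ - ((p : ℝ) - 2) * Khat) *
              θ ^ ((2 : ℝ) / ((p : ℝ) - 1)) ∧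
        0 < 2 * ((p : ℝ) - 1 / (p : ℝ)) * r * θ - ((p : ℝ) - 2) * Khat) ↔
       θ ∈ (if 0 < r
            then Set.Ioi (max ((p : ℝ) * Khat / (2 * ((p : ℝ) + 1) * r)) 0)
            else Set.Ioo 0 ((p : ℝ) * ((p : ℝ) - 2) * Khat / (2 * ((p : ℝ) ^ 2 - 1) * r)))) := by
  intro θ hθ
  have hq : (2 : ℝ) ≤ p := by exact_mod_cast hp
  have hq2 : r < 0 → (2 : ℝ) < p := fun h => by exact_mod_cast (hgbt h).1
  generalize (p : ℝ) = q at *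
  have hq0 : 0 < q := by linarith
  have hε : 2 * (q - 1 / q) * r * θ - (q - 1) * Khat =
      (q - 1) / q * (2 * (q + 1) * (r * θ) - q * Khat) := by
    field_simp
    ring
  have hc : q / 4 * (2 * (q - 1) * r * θ - (q - 2) * Khat) * θ ^ (2 / (q - 1)) =
      q / 4 * θ ^ (2 / (q - 1)) * (2 * (q - 1) * (r * θ) - (q - 2) * Khat) := by
    ring
  have hl : 2 * (q - 1 / q) * r * θ - (q - 2) * Khat =
      1 / q * (2 * (q ^ 2 - 1) * (r * θ) - q * (q - 2) * Khat) := by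
    field_simp
  have hθpow : 0 < θ ^ (2 / (q - 1)) := Real.rpow_pos_of_pos hθ _
  rw [hε, hc, hl, mul_pos_iff_of_pos_left (div_pos (by linarith) hq0),
    mul_pos_iff_of_pos_left (by positivity), mul_pos_iff_of_pos_left (by positivity)]
  split_ifs with hr0
  · have hmem : θ ∈ Set.Ioi (max (q * Khat / (2 * (q + 1) * r)) 0) ↔
        0 < 2 * (q + 1) * (r * θ) - q * Khat := by
      rw [Set.mem_Ioi, max_lt_iff, and_iff_left hθ, div_lt_iff₀ (by positivity), sub_pos,
        show θ * (2 * (q + 1) * r) = 2 * (q + 1) * (r * θ) by ring]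
    rw [hmem]
    exact ⟨And.left, fun h => ⟨h, pos_of_first_pos hq (mul_pos hr0 hθ) h⟩⟩
  · have hr0 : r < 0 := lt_of_le_of_ne (not_lt.1 hr0) hr
    have hden : 2 * (q ^ 2 - 1) * r < 0 := mul_neg_of_pos_of_neg (by nlinarith) hr0
    have hmem : θ ∈ Set.Ioo 0 (q * (q - 2) * Khat / (2 * (q ^ 2 - 1) * r)) ↔
        0 < 2 * (q ^ 2 - 1) * (r * θ) - q * (q - 2) * Khat := by
      rw [Set.mem_Ioo, and_iff_right hθ, lt_div_iff_of_neg hden, sub_pos,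
        show θ * (2 * (q ^ 2 - 1) * r) = 2 * (q ^ 2 - 1) * (r * θ) by ring]
    rw [hmem]
    refine ⟨fun h => h.2.2, fun h => ?_⟩
    obtain ⟨h₁, h₂⟩ := pos_of_third_pos (hq2 hr0) (hgbt hr0).2 h
    exact ⟨h₁, h₂, h⟩
end

section
/- Fix a natural number p with p ≥ 3 (cast to ℝ), real numbers ε, ε̃ with ε̃ < ε, and real numbers μ, μ̃. For K ∈ ℝ define ω(K) = (p−1)K + ε, ω̃(K) = (p−1)K + ε̃, Θ(K) = 2K + p·ε − μ·|ω(K)|^(2/(1−p)), Θ̃(K) = 2K + p·ε̃ − μ̃·|ω̃(K)|^(2/(1−p)), Σ(K) = (ω̃(K)²·Θ̃(K) − ω(K)²·Θ(K))/(2(p+1)(ε−ε̃)). Then, along both Filter.atTop and Filter.atBot, 2(p+1)·Σ(K)/K² tends to −(p−1)(p²−p+4) and (p+1)·(deriv Σ)(K)/K tends to −(p−1)(p²−p+4). -/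
noncomputable def omegaF (p ε : ℝ) (K : ℝ) : ℝ := (p - 1) * K + ε

noncomputable def ThetaF (p ε μ : ℝ) (K : ℝ) : ℝ :=
  2 * K + p * ε - μ * |omegaF p ε K| ^ ((2 : ℝ) / (1 - p))

noncomputable def SigmaF (p ε ε' μ μ' : ℝ) (K : ℝ) : ℝ :=
  ((omegaF p ε' K) ^ 2 * ThetaF p ε' μ' K - (omegaF p ε K) ^ 2 * ThetaF p ε μ K) /
    (2 * (p + 1) * (ε - ε'))

noncomputable def ZF (p ε ε' μ μ' : ℝ) (K : ℝ) : ℝ :=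
  (omegaF p ε K) * (omegaF p ε' K) *
      ((omegaF p ε' K) * ThetaF p ε' μ' K - (omegaF p ε K) * ThetaF p ε μ K) /
    (2 * (p + 1) * (3 * p - 2) * (ε - ε'))

open Filter Topology Bornology

theorem hasDerivAt_abs_rpow_of_ne_zero {x : ℝ} (hx : x ≠ 0) (s : ℝ) :
    HasDerivAt (fun y : ℝ => |y| ^ s) (s * |x| ^ s / x) x := by
  have hx' : |x| ≠ 0 := abs_ne_zero.mpr hx
  convert (hasDerivAt_abs hx).rpow_const (p := s) (Or.inl hx') using 1
  rw [Real.rpow_sub_one hx']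
  rcases lt_or_gt_of_ne hx with h | h
  · simp only [abs_of_neg h, sign_neg h]
    simp
    field_simp
  · simp only [abs_of_pos h, sign_pos h]
    simp
    field_simp

theorem hasDerivAt_omegaF (p ε K : ℝ) : HasDerivAt (omegaF p ε) (p - 1) K := by
  exact (((hasDerivAt_id K).const_mul (p - 1)).add_const ε).congr_deriv (mul_one _)

theorem hasDerivAt_omegaF_sq_mul_ThetaF (p ε μ : ℝ) {K : ℝ} (h : omegaF p ε K ≠ 0) :
    HasDerivAt (fun K => omegaF p ε K ^ 2 * ThetaF p ε μ K)
      (2 * (p - 1) * omegaF p ε K * ThetaF p ε μ K + 2 * omegaF p ε K ^ 2 -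
        μ * (2 / (1 - p)) * (p - 1) * |omegaF p ε K| ^ ((2 : ℝ) / (1 - p)) * omegaF p ε K) K := by
  have hω := hasDerivAt_omegaF p ε K
  have hr := (hasDerivAt_abs_rpow_of_ne_zero h ((2 : ℝ) / (1 - p))).comp K hω
  have hΘ : HasDerivAt (ThetaF p ε μ) _ K :=
    (((hasDerivAt_id K).const_mul 2).add_const (p * ε)).sub (hr.const_mul μ)
  refine ((hω.pow 2).mul hΘ).congr_deriv ?_
  simp only [Pi.pow_apply]
  field_simp
  push_cast
  ring

theorem tendsto_abs_omegaF_cobounded {p : ℝ} (hp : 1 < p) (ε : ℝ) :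
    Tendsto (fun K => |omegaF p ε K|) (cobounded ℝ) atTop := by
  have h : Tendsto (fun K : ℝ => (p - 1) * |K| - |ε|) (cobounded ℝ) atTop :=
    tendsto_atTop_add_const_right _ _
      ((tendsto_norm_cobounded_atTop (E := ℝ)).const_mul_atTop (sub_pos.mpr hp))
  refine tendsto_atTop_mono (fun K => ?_) h
  have := abs_sub_abs_le_abs_sub ((p - 1) * K) (-ε)
  rwa [abs_neg, sub_neg_eq_add, abs_mul, abs_of_pos (sub_pos.mpr hp)] at this

theorem tendsto_abs_omegaF_rpow_cobounded {p : ℝ} (hp : 1 < p) (ε : ℝ) :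
    Tendsto (fun K => |omegaF p ε K| ^ ((2 : ℝ) / (1 - p))) (cobounded ℝ) (𝓝 0) := by
  have hs : 0 < 2 / (p - 1) := div_pos two_pos (sub_pos.mpr hp)
  have e : (2 : ℝ) / (1 - p) = -(2 / (p - 1)) := by rw [← div_neg, neg_sub]
  rw [e]
  exact (tendsto_rpow_neg_atTop hs).comp (tendsto_abs_omegaF_cobounded hp ε)

theorem tendsto_SigmaF_div_sq_cobounded {p ε ε' : ℝ} (hp : 1 < p) (μ μ' : ℝ) (hε : ε' < ε) :
    Tendsto (fun K => 2 * (p + 1) * SigmaF p ε ε' μ μ' K / K ^ 2) (cobounded ℝ)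
      (𝓝 (-((p - 1) * (p ^ 2 - p + 4)))) := by
  have hu : Tendsto (fun K : ℝ => K⁻¹) (cobounded ℝ) (𝓝 0) := tendsto_inv₀_cobounded
  have hr := tendsto_abs_omegaF_rpow_cobounded hp ε
  have hr' := tendsto_abs_omegaF_rpow_cobounded hp ε'
  have hd : ε - ε' ≠ 0 := (sub_pos.mpr hε).ne'
  have hp1 : p + 1 ≠ 0 := by linarith
  have hlim : Tendsto (fun K : ℝ => -((p - 1) * (p ^ 2 - p + 4)) -
      (ε + ε') * (2 + 2 * p * (p - 1)) * K⁻¹ - p * (ε ^ 2 + ε * ε' + ε' ^ 2) * K⁻¹ ^ 2 +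
      (μ * (p - 1 + ε * K⁻¹) ^ 2 * |omegaF p ε K| ^ ((2 : ℝ) / (1 - p)) -
        μ' * (p - 1 + ε' * K⁻¹) ^ 2 * |omegaF p ε' K| ^ ((2 : ℝ) / (1 - p))) / (ε - ε'))
      (cobounded ℝ) (𝓝 (-((p - 1) * (p ^ 2 - p + 4)) -
      (ε + ε') * (2 + 2 * p * (p - 1)) * 0 - p * (ε ^ 2 + ε * ε' + ε' ^ 2) * 0 ^ 2 +
      (μ * (p - 1 + ε * 0) ^ 2 * 0 - μ' * (p - 1 + ε' * 0) ^ 2 * 0) / (ε - ε'))) :=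
    ((tendsto_const_nhds.sub (hu.const_mul _)).sub ((hu.pow 2).const_mul _)).add
      ((((((hu.const_mul ε).const_add (p - 1)).pow 2).const_mul μ).mul hr |>.sub
        (((((hu.const_mul ε').const_add (p - 1)).pow 2).const_mul μ').mul hr')).div_const _)
  simp only [mul_zero, sub_zero, zero_div, add_zero, ne_eq, OfNat.ofNat_ne_zero,
    not_false_eq_true, zero_pow] at hlim
  refine hlim.congr' ?_
  filter_upwards [eventually_ne_cobounded (0 : ℝ)] with K hK
  simp only [SigmaF, ThetaF]
  generalize |omegaF p ε K| ^ ((2 : ℝ) / (1 - p)) = r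
  generalize |omegaF p ε' K| ^ ((2 : ℝ) / (1 - p)) = r'
  simp only [omegaF]
  field_simp
  ring

theorem tendsto_deriv_SigmaF_div_cobounded {p ε ε' : ℝ} (hp : 1 < p) (μ μ' : ℝ) (hε : ε' < ε) :
    Tendsto (fun K => (p + 1) * deriv (SigmaF p ε ε' μ μ') K / K) (cobounded ℝ)
      (𝓝 (-((p - 1) * (p ^ 2 - p + 4)))) := by
  have hu : Tendsto (fun K : ℝ => K⁻¹) (cobounded ℝ) (𝓝 0) := tendsto_inv₀_cobounded
  have hr := tendsto_abs_omegaF_rpow_cobounded hp ε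
  have hr' := tendsto_abs_omegaF_rpow_cobounded hp ε'
  have hd : ε - ε' ≠ 0 := (sub_pos.mpr hε).ne'
  have hp1 : p + 1 ≠ 0 := by linarith
  have hlim : Tendsto (fun K : ℝ => -((p - 1) * (p ^ 2 - p + 4)) -
      (ε + ε') * (1 + p * (p - 1)) * K⁻¹ +
      (μ * (p - 2) * (p - 1 + ε * K⁻¹) * |omegaF p ε K| ^ ((2 : ℝ) / (1 - p)) -
        μ' * (p - 2) * (p - 1 + ε' * K⁻¹) * |omegaF p ε' K| ^ ((2 : ℝ) / (1 - p))) / (ε - ε'))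
      (cobounded ℝ) (𝓝 (-((p - 1) * (p ^ 2 - p + 4)) -
      (ε + ε') * (1 + p * (p - 1)) * 0 +
      (μ * (p - 2) * (p - 1 + ε * 0) * 0 - μ' * (p - 2) * (p - 1 + ε' * 0) * 0) / (ε - ε'))) :=
    (tendsto_const_nhds.sub (hu.const_mul _)).add
      (((((hu.const_mul ε).const_add (p - 1)).const_mul (μ * (p - 2))).mul hr |>.sub
        ((((hu.const_mul ε').const_add (p - 1)).const_mul (μ' * (p - 2))).mul hr')).div_const _)
  simp only [mul_zero, sub_zero, zero_div, add_zero] at hlim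
  refine hlim.congr' ?_
  filter_upwards [eventually_ne_cobounded (0 : ℝ),
    (tendsto_abs_omegaF_cobounded hp ε).eventually_gt_atTop 0,
    (tendsto_abs_omegaF_cobounded hp ε').eventually_gt_atTop 0] with K hK hω hω'
  have hderiv : HasDerivAt (SigmaF p ε ε' μ μ') _ K :=
    ((hasDerivAt_omegaF_sq_mul_ThetaF p ε' μ' (abs_pos.mp hω')).sub
      (hasDerivAt_omegaF_sq_mul_ThetaF p ε μ (abs_pos.mp hω))).div_const
        (2 * (p + 1) * (ε - ε'))
  have hs (c : ℝ) : c * (2 / (1 - p)) * (p - 1) = -2 * c := by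
    have : 1 - p ≠ 0 := by linarith
    field_simp
    ring
  rw [hderiv.deriv, hs, hs]
  simp only [ThetaF]
  generalize |omegaF p ε K| ^ ((2 : ℝ) / (1 - p)) = r
  generalize |omegaF p ε' K| ^ ((2 : ℝ) / (1 - p)) = r'
  simp only [omegaF]
  field_simp
  ring

theorem stmt_7 (p : ℕ) (hp : 3 ≤ p) (ε ε' μ μ' : ℝ) (hee : ε' < ε) :
    (Filter.Tendsto (fun K : ℝ => 2 * ((p : ℝ) + 1) * SigmaF (p : ℝ) ε ε' μ μ' K / K ^ 2)
        Filter.atTop (nhds (-(((p : ℝ) - 1) * ((p : ℝ) ^ 2 - (p : ℝ) + 4)))) ∧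
      Filter.Tendsto (fun K : ℝ => 2 * ((p : ℝ) + 1) * SigmaF (p : ℝ) ε ε' μ μ' K / K ^ 2)
        Filter.atBot (nhds (-(((p : ℝ) - 1) * ((p : ℝ) ^ 2 - (p : ℝ) + 4))))) ∧
    (Filter.Tendsto (fun K : ℝ => ((p : ℝ) + 1) * deriv (SigmaF (p : ℝ) ε ε' μ μ') K / K)
        Filter.atTop (nhds (-(((p : ℝ) - 1) * ((p : ℝ) ^ 2 - (p : ℝ) + 4)))) ∧
      Filter.Tendsto (fun K : ℝ => ((p : ℝ) + 1) * deriv (SigmaF (p : ℝ) ε ε' μ μ') K / K)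
        Filter.atBot (nhds (-(((p : ℝ) - 1) * ((p : ℝ) ^ 2 - (p : ℝ) + 4))))) := by
  have hp1 : (1 : ℝ) < p := by exact_mod_cast (by omega : 1 < p)
  have hlim := tendsto_SigmaF_div_sq_cobounded hp1 μ μ' hee
  have hlim' := tendsto_deriv_SigmaF_div_cobounded hp1 μ μ' hee
  have htop : atTop ≤ cobounded ℝ := IsOrderBornology.atTop_le_cobounded
  have hbot : atBot ≤ cobounded ℝ := IsOrderBornology.atBot_le_cobounded
  exact ⟨⟨hlim.mono_left htop, hlim.mono_left hbot⟩, hlim'.mono_left htop, hlim'.mono_left hbot⟩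
end
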